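/- An inverse semigroup S is tightly connected if and only if S is shortly connected and N_S ∪ E_S is an order ideal of (S, ≤), i.e. whenever y ≤ x in the natural partial order and x ∈ N_S ∪ E_S, then y ∈ N_S ∪ E_S. -/

import Mathlib

/-- An inverse semigroup: a semigroup in which every element `a` has a unique
element `a⁻¹` with `a * a⁻¹ * a = a` and `a⁻¹ * a * a⁻¹ = a⁻¹`. -/
class InverseSemigroup (S : Type*) extends Semigroup S, Inv S where
  mul_inv_mul : ∀ a : S, a * a⁻¹ * a = a
  inv_mul_inv : ∀ a : S, a⁻¹ * a * a⁻¹ = a⁻¹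
  inv_unique : ∀ a b : S, a * b * a = a → b * a * b = b → b = a⁻¹

section InvSgDefs

variable (S : Type*) [InverseSemigroup S]

/-- The set of idempotents of `S`. -/
def ES : Set S := {e : S | IsIdempotentElem e}

/-- The set of nongroup elements of `S`. -/
def NS : Set S := {x : S | x * x⁻¹ ≠ x⁻¹ * x}

/-- `N_S ∪ E_S`. -/
def NE : Set S := NS S ∪ ES S

variable {S}

/-- The order on idempotents: `e ≤ f` iff `e * f = e`. -/
def idemLe (e f : S) : Prop := e * f = e

/-- Strict order on idempotents. -/
def idemLt (e f : S) : Prop := idemLe e f ∧ e ≠ f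

/-- The natural partial order on an inverse semigroup: `a ≤ b` iff `a = e * b`
for some idempotent `e`. -/
def natLe (a b : S) : Prop := ∃ e : S, IsIdempotentElem e ∧ a = e * b

/-- Green's relation `𝓡`. -/
def rRel (a b : S) : Prop := a * a⁻¹ = b * b⁻¹

/-- Green's relation `𝓛`. -/
def lRel (a b : S) : Prop := a⁻¹ * a = b⁻¹ * b

/-- Green's relation `𝓗`. -/
def hRel (a b : S) : Prop := rRel a b ∧ lRel a b

/-- Green's relation `𝓓`. -/
def dRel (a b : S) : Prop := ∃ c : S, rRel a c ∧ lRel c b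

/-- `U` is an inverse subsemigroup of `S`: closed under multiplication and inversion. -/
def IsInvSub (U : Set S) : Prop :=
  (∀ a ∈ U, ∀ b ∈ U, a * b ∈ U) ∧ ∀ a ∈ U, a⁻¹ ∈ U

/-- The inverse subsemigroup generated by `X`: the smallest subset of `S`
containing `X` and closed under multiplication and inversion. -/
def genInv (X : Set S) : Set S := ⋂₀ {U : Set S | IsInvSub U ∧ X ⊆ U}

/-- `e` is `x`-covered by `x * x⁻¹`: `e < x * x⁻¹` and no idempotent `f` of `⟨x⟩`
satisfies `e < f < x * x⁻¹`. -/
def XCov (x e : S) : Prop :=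
  idemLt e (x * x⁻¹) ∧
    ∀ f ∈ genInv ({x} : Set S), IsIdempotentElem f →
      ¬(idemLt e f ∧ idemLt f (x * x⁻¹))

/-- `e` is tightly `x`-covered by `x * x⁻¹`. -/
def TightXCov (x e : S) : Prop :=
  XCov x e ∧ (e * x ∈ NS S ∨ IsIdempotentElem (e * x))

/-- A short bypass from `e` to `x * x⁻¹`. -/
def ShortBypass (x e : S) : Prop :=
  ∃ n : ℕ, 1 ≤ n ∧ ∃ es : ℕ → S,
    es 0 = e ∧ es n = x * x⁻¹ ∧ (∀ k ≤ n, IsIdempotentElem (es k)) ∧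
    ∀ k : ℕ, 1 ≤ k → k ≤ n → idemLt (es (k - 1)) (es k) ∧ XCov (es k * x) (es (k - 1))

/-- A tight bypass from `e` to `x * x⁻¹`. -/
def TightBypass (x e : S) : Prop :=
  ∃ n : ℕ, 1 ≤ n ∧ ∃ es : ℕ → S,
    es 0 = e ∧ es n = x * x⁻¹ ∧ (∀ k ≤ n, IsIdempotentElem (es k)) ∧
    ∀ k : ℕ, 1 ≤ k → k ≤ n → idemLt (es (k - 1)) (es k) ∧ TightXCov (es k * x) (es (k - 1))

variable (S)

/-- `S` is shortly connected. -/
def ShortlyConnected : Prop :=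
  ∀ x : S, ∀ e : S, IsIdempotentElem e → idemLt e (x * x⁻¹) → ShortBypass x e

/-- `S` is tightly connected. -/
def TightlyConnected : Prop :=
  ∀ x ∈ NE S, ∀ e : S, IsIdempotentElem e → idemLt e (x * x⁻¹) → TightBypass x e

/-- `S` is fundamental. -/
def Fundamental : Prop :=
  ∀ x y : S, (∀ e : S, IsIdempotentElem e → x⁻¹ * e * x = y⁻¹ * e * y) → x = y

/-- `S` is combinatorial. -/
def Combinatorial : Prop :=
  ∀ a b : S, a * a⁻¹ = b * b⁻¹ → a⁻¹ * a = b⁻¹ * b → a = b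

/-- `S` has no isolated nontrivial subgroups: for every idempotent `e` whose
`𝓗`-class is nontrivial there is an idempotent `f ≠ e` with `e 𝓓 f`. -/
def NoIsolatedNontrivial : Prop :=
  ∀ e : S, IsIdempotentElem e → (∃ h : S, h ≠ e ∧ hRel h e) →
    ∃ f : S, IsIdempotentElem f ∧ f ≠ e ∧ dRel e f

/-- `S` is completely semisimple. -/
def CompletelySemisimple : Prop :=
  ∀ e f : S, IsIdempotentElem e → IsIdempotentElem f → idemLe e f → dRel e f → e = f

end InvSgDefs

section Helpers

variable {S : Type*} [InverseSemigroup S]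

open InverseSemigroup

lemma isg_inv_inv (a : S) : a⁻¹⁻¹ = a :=
  (inv_unique a⁻¹ a (inv_mul_inv a) (mul_inv_mul a)).symm

lemma isg_inv_idem {e : S} (h : IsIdempotentElem e) : e⁻¹ = e :=
  (inv_unique e e (by rw [h.eq, h.eq]) (by rw [h.eq, h.eq])).symm

lemma isg_idem_mul {e f : S} (he : IsIdempotentElem e) (hf : IsIdempotentElem f) :
    IsIdempotentElem (e * f) := by
  have he' : ∀ z : S, e * (e * z) = e * z := fun z => by rw [← mul_assoc, he.eq]
  have hf' : ∀ z : S, f * (f * z) = f * z := fun z => by rw [← mul_assoc, hf.eq]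
  have h1 := mul_inv_mul (e * f)
  have h2 := inv_mul_inv (e * f)
  generalize hb : (e * f)⁻¹ = b at h1 h2
  have h3 : f * b * e = b := by
    rw [← hb]
    apply InverseSemigroup.inv_unique
    · rw [hb]
      simp only [mul_assoc, he', hf'] at h1 ⊢
      exact h1
    · rw [hb]
      have : f * (b * (e * f) * b) * e = f * b * e := by rw [h2]
      simp only [mul_assoc, he', hf'] at this ⊢
      exact this
  have h4 : IsIdempotentElem b := by
    have : f * (b * (e * f) * b) * e = f * b * e := by rw [h2]
    unfold IsIdempotentElem
    conv_lhs => rw [← h3]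
    rw [h3] at this
    simp only [mul_assoc] at this ⊢
    exact this
  have h5 : e * f = b := by
    rw [← isg_inv_idem h4, ← hb, isg_inv_inv]
  rw [h5]; exact h4

lemma isg_xx (x : S) : IsIdempotentElem (x * x⁻¹) := by
  unfold IsIdempotentElem
  rw [← mul_assoc, mul_inv_mul]

/-- Idempotents in the monogenic subsemigroup of a group element. -/
lemma isg_group_gen {x : S} (hx : x * x⁻¹ = x⁻¹ * x) {f : S}
    (hf : f ∈ genInv ({x} : Set S)) (hi : IsIdempotentElem f) : f = x * x⁻¹ := by
  have key : f ∈ {a : S | a * a⁻¹ = x * x⁻¹ ∧ a⁻¹ * a = x * x⁻¹} := by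
    apply hf
    refine ⟨⟨?_, ?_⟩, ?_⟩
    · rintro a ⟨ha1, ha2⟩ b ⟨hb1, hb2⟩
      generalize x * x⁻¹ = g at ha1 ha2 hb1 hb2
      have ga : g * a = a := by rw [← ha1, mul_inv_mul]
      have gb : g * b = b := by rw [← hb1, mul_inv_mul]
      have ga' : g * a⁻¹ = a⁻¹ := by rw [← ha2, inv_mul_inv]
      have gb' : g * b⁻¹ = b⁻¹ := by rw [← hb2, inv_mul_inv]
      have e1 : (a * b) * (b⁻¹ * a⁻¹) = g := by
        rw [mul_assoc, ← mul_assoc b, hb1, ga', ha1]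
      have e2 : (b⁻¹ * a⁻¹) * (a * b) = g := by
        rw [mul_assoc, ← mul_assoc a⁻¹, ha2, gb, hb2]
      have e3 : b⁻¹ * a⁻¹ = (a * b)⁻¹ := by
        apply InverseSemigroup.inv_unique
        · rw [e1, ← mul_assoc, ga]
        · rw [e2, ← mul_assoc, gb']
      show _ ∧ _
      rw [← e3]
      exact ⟨e1, e2⟩
    · rintro a ⟨ha1, ha2⟩
      show _ ∧ _
      rw [isg_inv_inv]
      exact ⟨ha2, ha1⟩
    · rintro a rfl
      exact ⟨rfl, hx.symm⟩
  have h := key.1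
  rw [isg_inv_idem hi, hi.eq] at h
  exact h

end Helpers

/-- an inverse semigroup is tightly connected iff it is shortly
connected and `N_S ∪ E_S` is an order ideal for the natural partial order. -/
theorem stmt12 {S : Type*} [InverseSemigroup S] :
    TightlyConnected S ↔
      (ShortlyConnected S ∧ ∀ x ∈ NE S, ∀ y : S, natLe y x → y ∈ NE S) := by
  constructor
  · intro hT
    refine ⟨?_, ?_⟩
    · intro x e he hlt
      by_cases hx : x ∈ NE S
      · obtain ⟨n, hn, es, h0, h1, h2, h3⟩ := hT x hx e he hlt
        exact ⟨n, hn, es, h0, h1, h2, fun k hk hk' => ⟨(h3 k hk hk').1, (h3 k hk hk').2.1⟩⟩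
      · have hg : x * x⁻¹ = x⁻¹ * x := by
          by_contra h
          exact hx (Or.inl h)
        refine ⟨1, le_rfl, fun k => if k = 0 then e else x * x⁻¹, by simp, by simp, ?_, ?_⟩
        · intro k _
          by_cases hk : k = 0
          · simpa [hk] using he
          · simpa [hk] using isg_xx x
        · intro k hk hk'
          obtain rfl : k = 1 := le_antisymm hk' hk
          simp only [Nat.sub_self, if_true, one_ne_zero, if_false,
            InverseSemigroup.mul_inv_mul]
          refine ⟨hlt, hlt, ?_⟩
          rintro f hf hi ⟨_, h⟩
          exact h.2 (isg_group_gen hg hf hi)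
    · rintro x hx y ⟨e, he, rfl⟩
      have hfx : e * (x * x⁻¹) * x = e * x := by
        rw [mul_assoc, InverseSemigroup.mul_inv_mul]
      by_cases hE : e * (x * x⁻¹) = x * x⁻¹
      · rw [← hfx, hE, InverseSemigroup.mul_inv_mul]
        exact hx
      · obtain ⟨n, hn, es, h0, h1, h2, h3⟩ := hT x hx (e * (x * x⁻¹))
          (isg_idem_mul he (isg_xx x))
          ⟨by unfold idemLe; rw [mul_assoc, (isg_xx x).eq], hE⟩
        obtain ⟨h4, h5⟩ := h3 1 le_rfl hn
        have h6 := h5.2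
        have h7 : es (1 - 1) * es 1 = es (1 - 1) := h4.1
        rw [← mul_assoc, h7, Nat.sub_self, h0, hfx] at h6
        exact h6
  · rintro ⟨hS, hI⟩ x hx e he hlt
    obtain ⟨n, hn, es, h0, h1, h2, h3⟩ := hS x e he hlt
    refine ⟨n, hn, es, h0, h1, h2, fun k hk hk' => ⟨(h3 k hk hk').1, (h3 k hk hk').2, ?_⟩⟩
    have h7 : es (k - 1) * es k = es (k - 1) := (h3 k hk hk').1.1
    rw [← mul_assoc, h7]
    exact hI x hx _ ⟨es (k - 1), h2 _ (by omega), rfl⟩
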